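/- If n > 1 is a product of at most three primes counted with multiplicity (i.e., Ω(n) ≤ 3), then the n×n square has no perfect Mondrian partition. -/

import Mathlib

/-- An axis-aligned rectangle with integer coordinates placed on the grid:
lower-left corner `(x, y)`, width `w`, and height `h`. -/
structure Rect where
  x : ℕ
  y : ℕ
  w : ℕ
  h : ℕ
deriving DecidableEq

/-- The area of a rectangle. -/
def Rect.area (r : Rect) : ℕ := r.w * r.h

/-- Two rectangles are congruent if they have the same dimensions,
possibly after a ninety-degree rotation. -/
def Rect.Congruent (r s : Rect) : Prop :=
  (r.w = s.w ∧ r.h = s.h) ∨ (r.w = s.h ∧ r.h = s.w)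

/-- The rectangle `r` covers the unit grid cell `[i, i+1) × [j, j+1)`. -/
def Rect.Covers (r : Rect) (i j : ℕ) : Prop :=
  r.x ≤ i ∧ i < r.x + r.w ∧ r.y ≤ j ∧ j < r.y + r.h

/-- A Mondrian partition of the `n × n` square: a finite collection of
pairwise non-congruent rectangles with positive integer side lengths that
tile the square (every cell of the square is covered by exactly one
rectangle, and rectangles lie inside the square). -/
structure Mondrian (n : ℕ) where
  rects : Finset Rect
  pos : ∀ r ∈ rects, 0 < r.w ∧ 0 < r.h
  inside : ∀ r ∈ rects, r.x + r.w ≤ n ∧ r.y + r.h ≤ n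
  cover : ∀ i j : ℕ, i < n → j < n → ∃! r : Rect, r ∈ rects ∧ r.Covers i j
  noncong : ∀ r ∈ rects, ∀ s ∈ rects, r ≠ s → ¬ r.Congruent s

/-- The defect of a Mondrian partition: the difference between the largest
and the smallest rectangle areas. -/
def Mondrian.defect {n : ℕ} (P : Mondrian n) : ℕ :=
  P.rects.sup fun r => P.rects.sup fun s => r.area - s.area

/-- A Mondrian partition is perfect if all its rectangles have the same area. -/
def Mondrian.IsPerfect {n : ℕ} (P : Mondrian n) : Prop :=
  ∀ r ∈ P.rects, ∀ s ∈ P.rects, r.area = s.area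

/-- `mondrianDk n k` is the minimum defect over all Mondrian partitions of the
`n × n` square using exactly `k` rectangles. -/
noncomputable def mondrianDk (n k : ℕ) : ℕ :=
  sInf {d | ∃ P : Mondrian n, P.rects.card = k ∧ P.defect = d}

/-- `mondrianD n` is the minimum defect over all Mondrian partitions of the
`n × n` square (into at least two rectangles). -/
noncomputable def mondrianD (n : ℕ) : ℕ :=
  sInf {d | ∃ P : Mondrian n, 2 ≤ P.rects.card ∧ P.defect = d}

theorem Nat.card_divisors_mul_le (a b : ℕ) :
    (a * b).divisors.card ≤ a.divisors.card * b.divisors.card := by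
  rw [Nat.divisors_mul]
  exact Finset.card_mul_le

/-- The number of divisors of `n ^ e` is at most `(e + 1) ^ Ω n`. -/
theorem Nat.card_divisors_pow_le (e n : ℕ) (hn : n ≠ 0) :
    (n ^ e).divisors.card ≤ (e + 1) ^ ArithmeticFunction.cardFactors n := by
  induction n using Nat.recOnMul with
  | zero => exact absurd rfl hn
  | one => simp
  | prime p hp =>
    rw [Nat.divisors_prime_pow hp, ArithmeticFunction.cardFactors_apply_prime hp]
    simp
  | mul a b iha ihb =>
    have ha : a ≠ 0 := left_ne_zero_of_mul hn
    have hb : b ≠ 0 := right_ne_zero_of_mul hn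
    rw [ArithmeticFunction.cardFactors_mul ha hb, mul_pow, pow_add]
    exact (Nat.card_divisors_mul_le _ _).trans (Nat.mul_le_mul (iha ha) (ihb hb))

theorem Nat.two_mul_card_filter_divisors_le (A : ℕ) :
    2 * (A.divisors.filter (fun v => A ≤ v * v)).card ≤ A.divisors.card + 1 := by
  set S := A.divisors.filter (fun v => A ≤ v * v) with hS
  set T := A.divisors.filter (fun v => v * v ≤ A) with hT
  have hST : S.card ≤ T.card := by
    refine Finset.card_le_card_of_injOn (fun v => A / v) ?_ ?_
    · intro v hv
      simp only [hS, hT, Finset.coe_filter, Set.mem_ofPred_eq, Nat.mem_divisors] at hv ⊢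
      obtain ⟨⟨⟨d, rfl⟩, h0⟩, h⟩ := hv
      have hv0 : 0 < v := Nat.pos_of_ne_zero (left_ne_zero_of_mul h0)
      rw [Nat.mul_div_cancel_left _ hv0]
      have : d ≤ v := Nat.le_of_mul_le_mul_left h hv0
      exact ⟨⟨dvd_mul_left _ _, h0⟩, Nat.mul_le_mul_right _ this⟩
    · intro v hv u hu huv
      simp only [hS, Finset.coe_filter, Set.mem_ofPred_eq, Nat.mem_divisors] at hv hu huv
      rw [← Nat.div_div_self hv.1.1 hv.1.2, huv, Nat.div_div_self hu.1.1 hu.1.2]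
  have hunion : (S ∪ T).card ≤ A.divisors.card :=
    Finset.card_le_card (Finset.union_subset (Finset.filter_subset _ _) (Finset.filter_subset _ _))
  have hinter : (S ∩ T).card ≤ 1 := by
    refine Finset.card_le_one.2 fun a ha b hb => ?_
    simp only [hS, hT, Finset.mem_inter, Finset.mem_filter] at ha hb
    exact Nat.mul_self_inj.1 (by omega)
  have := Finset.card_union_add_card_inter S T
  omega

theorem Nat.two_mul_card_filter_divisors_add_le {n A : ℕ} (hA : A ≠ 0) (T : Finset ℕ)
    (hT : ∀ x ∈ T, x ∣ A ∧ A ≤ x * x ∧ n < x) :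
    2 * ((A.divisors.filter (fun v => A ≤ v * v ∧ v ≤ n)).card + T.card) ≤
      A.divisors.card + 1 := by
  refine le_trans (Nat.mul_le_mul_left 2 ?_) A.two_mul_card_filter_divisors_le
  rw [← Finset.card_union_of_disjoint]
  · refine Finset.card_le_card fun x hx => ?_
    simp only [Finset.mem_union, Finset.mem_filter, Nat.mem_divisors] at hx ⊢
    rcases hx with ⟨h1, h2, -⟩ | hx
    · exact ⟨h1, h2⟩
    · exact ⟨⟨(hT x hx).1, hA⟩, (hT x hx).2.1⟩
  · refine Finset.disjoint_left.2 fun x hx hx' => ?_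
    exact (hT x hx').2.2.not_ge (Finset.mem_filter.1 hx).2.2

/-- `S` meets the set of side lengths of every rectangle of area `A` that fits in the
`n × n` square. -/
def IsSideSet (n A : ℕ) (S : Finset ℕ) : Prop :=
  ∀ w h : ℕ, w * h = A → w ≤ n → h ≤ n → w ∈ S ∨ h ∈ S

theorem isSideSet_filter_divisors {n A : ℕ} (hA : A ≠ 0) :
    IsSideSet n A (A.divisors.filter (fun v => A ≤ v * v ∧ v ≤ n)) := by
  intro w h hwh hw hh
  subst hwh
  rcases le_total w h with hle | hle
  · right
    simpa [mul_ne_zero_iff.1 hA, hh] using Nat.mul_le_mul_right h hle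
  · left
    simpa [mul_ne_zero_iff.1 hA, hw] using Nat.mul_le_mul_left w hle

theorem isSideSet_of_prime {p m : ℕ} (hp : p.Prime) (hm : m ≠ 0) :
    IsSideSet (p * m) (p * m ^ 2)
      ((m ^ 2).divisors.filter (fun v => m ^ 2 ≤ v * v ∧ v ≤ p * m)) := by
  have key : ∀ a v : ℕ, a * v = m ^ 2 → p * a ≤ p * m → v ≤ p * m →
      v ∈ (m ^ 2).divisors.filter (fun v => m ^ 2 ≤ v * v ∧ v ≤ p * m) := by
    intro a v hav ha hv
    have ham : a ≤ m := Nat.le_of_mul_le_mul_left ha hp.pos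
    have hmv : m ≤ v := by
      by_contra! hlt
      have : a * v < m * m :=
        (Nat.mul_le_mul_right v ham).trans_lt
          (Nat.mul_lt_mul_of_pos_left hlt (Nat.pos_of_ne_zero hm))
      rw [hav, sq] at this
      exact lt_irrefl _ this
    simp only [Finset.mem_filter, Nat.mem_divisors]
    exact ⟨⟨Dvd.intro_left a hav, pow_ne_zero 2 hm⟩, by rw [sq]; exact Nat.mul_le_mul hmv hmv, hv⟩
  intro w h hwh hw hh
  rcases (Nat.Prime.dvd_mul hp).1 (Dvd.intro _ hwh.symm) with ⟨a, rfl⟩ | ⟨a, rfl⟩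
  · right
    exact key a h (Nat.eq_of_mul_eq_mul_left hp.pos (by rw [← hwh]; ring)) hw hh
  · left
    exact key a w (Nat.eq_of_mul_eq_mul_left hp.pos (by rw [← hwh]; ring)) hh hw

namespace Mondrian

variable {n : ℕ} (P : Mondrian n)

theorem sum_area : ∑ r ∈ P.rects, r.area = n ^ 2 := by
  have hmem : ∀ (r : Rect) (c : ℕ × ℕ),
      c ∈ Finset.Ico r.x (r.x + r.w) ×ˢ Finset.Ico r.y (r.y + r.h) ↔ r.Covers c.1 c.2 := by
    intro r c
    simp [Rect.Covers, and_assoc]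
  have hU : P.rects.biUnion
      (fun r => Finset.Ico r.x (r.x + r.w) ×ˢ Finset.Ico r.y (r.y + r.h)) =
      Finset.range n ×ˢ Finset.range n := by
    ext c
    simp only [Finset.mem_biUnion, hmem, Finset.mem_product, Finset.mem_range]
    constructor
    · rintro ⟨r, hr, h⟩
      have := P.inside r hr
      unfold Rect.Covers at h
      omega
    · rintro ⟨h1, h2⟩
      exact (P.cover _ _ h1 h2).exists
  have hdis : (P.rects : Set Rect).PairwiseDisjoint
      (fun r => Finset.Ico r.x (r.x + r.w) ×ˢ Finset.Ico r.y (r.y + r.h)) := by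
    intro r hr s hs hrs
    refine Finset.disjoint_left.2 fun c hc hc' => hrs ?_
    rw [hmem] at hc hc'
    have := P.inside r hr
    refine (P.cover c.1 c.2 ?_ ?_).unique ⟨hr, hc⟩ ⟨hs, hc'⟩ <;> unfold Rect.Covers at hc <;> omega
  have := Finset.card_biUnion hdis
  rw [hU] at this
  simpa [Rect.area, sq] using this.symm

variable {P}

theorem IsPerfect.card_le (hP : P.IsPerfect) {S : Finset ℕ}
    (hS : ∀ r ∈ P.rects, r.w ∈ S ∨ r.h ∈ S) : P.rects.card ≤ S.card := by
  refine Finset.card_le_card_of_injOn (fun r => if r.w ∈ S then r.w else r.h) ?_ ?_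
  · intro r hr
    have := hS r hr
    dsimp only
    split_ifs <;> simp_all
  · intro r hr s hs hrs
    by_contra hne
    refine P.noncong r hr s hs hne ?_
    have hA := hP r hr s hs
    obtain ⟨hw, hh⟩ := P.pos r hr
    obtain ⟨hw', hh'⟩ := P.pos s hs
    unfold Rect.area at hA
    unfold Rect.Congruent
    dsimp only at hrs
    split_ifs at hrs with h1 h2 h2
    · rw [hrs] at hA
      exact .inl ⟨hrs, Nat.eq_of_mul_eq_mul_left hw' hA⟩
    · rw [hrs, mul_comm] at hA
      exact .inr ⟨hrs, Nat.eq_of_mul_eq_mul_right hh' hA⟩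
    · rw [hrs, mul_comm s.w] at hA
      exact .inr ⟨Nat.eq_of_mul_eq_mul_right hw' hA, hrs⟩
    · rw [hrs] at hA
      exact .inl ⟨Nat.eq_of_mul_eq_mul_right hh' hA, hrs⟩

/-- The reflection of a partition in the diagonal of the square. -/
def transpose (P : Mondrian n) : Mondrian n where
  rects := P.rects.image fun r => ⟨r.y, r.x, r.h, r.w⟩
  pos := by
    simp only [Finset.forall_mem_image]
    exact fun r hr => (P.pos r hr).symm
  inside := by
    simp only [Finset.forall_mem_image]
    exact fun r hr => (P.inside r hr).symm
  cover := by
    intro i j hi hj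
    obtain ⟨r, ⟨hr, hc⟩, hu⟩ := P.cover j i hj hi
    refine ⟨⟨r.y, r.x, r.h, r.w⟩, ⟨Finset.mem_image_of_mem _ hr, ?_⟩, ?_⟩
    · unfold Rect.Covers at *
      dsimp only
      omega
    · rintro s ⟨hs, hc'⟩
      obtain ⟨t, ht, rfl⟩ := Finset.mem_image.1 hs
      rw [hu t ⟨ht, by unfold Rect.Covers at *; dsimp only at hc'; omega⟩]
  noncong := by
    simp only [Finset.forall_mem_image]
    intro r hr s hs hne hc
    refine P.noncong r hr s hs (fun h => hne (by rw [h])) ?_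
    unfold Rect.Congruent at *
    dsimp only at hc
    omega

theorem card_transpose : P.transpose.rects.card = P.rects.card := by
  refine Finset.card_image_of_injective _ ?_
  rintro ⟨⟩ ⟨⟩ h
  simp only [Rect.mk.injEq] at h ⊢
  tauto

theorem IsPerfect.transpose (hP : P.IsPerfect) : P.transpose.IsPerfect := by
  unfold IsPerfect Mondrian.transpose
  simp only [Finset.forall_mem_image]
  intro r hr s hs
  have := hP r hr s hs
  unfold Rect.area at *
  dsimp only
  rw [mul_comm r.h, mul_comm s.h, this]

theorem IsPerfect.three_lt_card_of_width_eq (hP : P.IsPerfect) (hk : 2 ≤ P.rects.card)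
    {R : Rect} (hR : R ∈ P.rects) (hRw : R.w = n) : 3 < P.rects.card := by
  by_contra! hk3
  have hn : 0 < n := hRw ▸ (P.pos R hR).1
  have hRin := P.inside R hR
  have hRx : R.x = 0 := by omega
  have hcong : ∀ s ∈ P.rects, s.w = n → s = R := by
    intro s hs hsw
    by_contra hne
    refine P.noncong s hs R hR hne (.inl ⟨hsw.trans hRw.symm, ?_⟩)
    have := hP s hs R hR
    unfold Rect.area at this
    rw [hsw, hRw] at this
    exact Nat.eq_of_mul_eq_mul_left hn this
  have hRcov : ∀ s ∈ P.rects, s ≠ R → ∀ i j, s.Covers i j → ¬ (R.y ≤ j ∧ j < R.y + R.h) := by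
    intro s hs hne i j hc hj
    have hsin := P.inside s hs
    refine hne ((P.cover i j ?_ ?_).unique ⟨hs, hc⟩ ⟨hR, ?_⟩) <;> unfold Rect.Covers at * <;> omega
  obtain ⟨Q, hQ, hQR⟩ := Finset.exists_mem_ne hk R
  have hQpos := P.pos Q hQ
  have hQin := P.inside Q hQ
  have hQy := hRcov Q hQ hQR Q.x Q.y (by unfold Rect.Covers; omega)
  obtain ⟨S, ⟨hS, hSc⟩, -⟩ := P.cover 0 Q.y hn (by omega)
  obtain ⟨T, ⟨hT, hTc⟩, -⟩ := P.cover (n - 1) Q.y (by omega) (by omega)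
  have hSin := P.inside S hS
  have hTin := P.inside T hT
  have hSR : S ≠ R := by
    rintro rfl
    unfold Rect.Covers at hSc
    omega
  have hTR : T ≠ R := by
    rintro rfl
    unfold Rect.Covers at hTc
    omega
  have hSw : S.w ≠ n := fun h => hSR (hcong S hS h)
  have hTw : T.w ≠ n := fun h => hTR (hcong T hT h)
  have hST : S ≠ T := by
    rintro rfl
    unfold Rect.Covers at hSc hTc
    omega
  have hall : ∀ s ∈ P.rects, s = R ∨ s = S ∨ s = T := by
    have hsub : ({R, S, T} : Finset Rect) ⊆ P.rects := by
      simp [Finset.insert_subset_iff, hR, hS, hT]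
    have hc : ({R, S, T} : Finset Rect).card = 3 :=
      Finset.card_eq_three.2 ⟨R, S, T, hSR.symm, hTR.symm, hST, rfl⟩
    have := Finset.eq_of_subset_of_card_le hsub (by omega)
    intro s hs
    rw [← this] at hs
    simpa using hs
  have hSrow : ∀ j < n, ¬ (R.y ≤ j ∧ j < R.y + R.h) → S.y ≤ j ∧ j < S.y + S.h := by
    intro j hj hjR
    obtain ⟨s, ⟨hs, hc⟩, -⟩ := P.cover 0 j hn hj
    unfold Rect.Covers at hc hTc
    rcases hall s hs with rfl | rfl | rfl <;> omega
  have hTrow : ∀ j < n, ¬ (R.y ≤ j ∧ j < R.y + R.h) → T.y ≤ j ∧ j < T.y + T.h := by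
    intro j hj hjR
    obtain ⟨s, ⟨hs, hc⟩, -⟩ := P.cover (n - 1) j (by omega) hj
    unfold Rect.Covers at hc hSc
    rcases hall s hs with rfl | rfl | rfl <;> omega
  have hSpos := P.pos S hS
  have hTpos := P.pos T hT
  have h1 := hTrow S.y (by omega) (hRcov S hS hSR S.x _ (by unfold Rect.Covers; omega))
  have h2 := hTrow (S.y + S.h - 1) (by omega)
    (hRcov S hS hSR S.x _ (by unfold Rect.Covers; omega))
  have h3 := hSrow T.y (by omega) (hRcov T hT hTR T.x _ (by unfold Rect.Covers; omega))
  have h4 := hSrow (T.y + T.h - 1) (by omega)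
    (hRcov T hT hTR T.x _ (by unfold Rect.Covers; omega))
  have hh : S.h = T.h := by omega
  refine P.noncong S hS T hT hST (.inl ⟨?_, hh⟩)
  have := hP S hS T hT
  unfold Rect.area at this
  rw [hh] at this
  exact Nat.eq_of_mul_eq_mul_right hTpos.2 this

/-- A perfect Mondrian partition has at least four rectangles. -/
theorem IsPerfect.three_lt_card (hP : P.IsPerfect) (hn : 0 < n) (hk : 2 ≤ P.rects.card) :
    3 < P.rects.card := by
  have hside : ∀ R ∈ P.rects, R.w = n ∨ R.h = n → 3 < P.rects.card := by
    rintro R hR (hw | hh)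
    · exact hP.three_lt_card_of_width_eq hk hR hw
    · rw [← card_transpose] at hk ⊢
      exact hP.transpose.three_lt_card_of_width_eq hk
        (R := ⟨R.y, R.x, R.h, R.w⟩) (Finset.mem_image_of_mem _ hR) hh
  by_contra! hlt
  obtain ⟨a, ⟨ha, hac⟩, -⟩ := P.cover 0 0 hn hn
  obtain ⟨b, ⟨hb, hbc⟩, -⟩ := P.cover (n - 1) 0 (by omega) hn
  obtain ⟨c, ⟨hc, hcc⟩, -⟩ := P.cover 0 (n - 1) hn (by omega)
  obtain ⟨d, ⟨hd, hdc⟩, -⟩ := P.cover (n - 1) (n - 1) (by omega) (by omega)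
  have hno : ∀ R ∈ P.rects, R.w ≠ n ∧ R.h ≠ n := fun R hR =>
    not_or.1 fun h => (hside R hR h).not_ge hlt
  have ha' := hno a ha
  have hb' := hno b hb
  have hc' := hno c hc
  have hd' := hno d hd
  have hai := P.inside a ha
  have hbi := P.inside b hb
  have hci := P.inside c hc
  have hdi := P.inside d hd
  unfold Rect.Covers at hac hbc hcc hdc
  have hsub : ({a, b, c, d} : Finset Rect) ⊆ P.rects := by
    simp [Finset.insert_subset_iff, ha, hb, hc, hd]
  have hcard : ({a, b, c, d} : Finset Rect).card = 4 := by
    refine Finset.card_eq_four.2 ⟨a, b, c, d, ?_, ?_, ?_, ?_, ?_, ?_, rfl⟩ <;> rintro rfl <;> omega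
  have := Finset.card_le_card hsub
  omega

end Mondrian

open ArithmeticFunction in
/-- If `n` has at most three prime factors, then there are fewer than `k ≥ 4` shapes of
rectangles of area `n ^ 2 / k` that fit in the `n × n` square. -/
theorem exists_isSideSet_card_lt {n k A : ℕ} (hn : n ≠ 0) (hΩ : cardFactors n ≤ 3) (hk : 4 ≤ k)
    (hkA : k * A = n ^ 2) : ∃ S, IsSideSet n A S ∧ S.card < k := by
  have hkA0 : k * A ≠ 0 := hkA ▸ pow_ne_zero 2 hn
  have hA : A ≠ 0 := right_ne_zero_of_mul hkA0
  have hcard := Nat.two_mul_card_filter_divisors_add_le (n := n) hA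
  have hcof : ∀ {c m : ℕ}, n = c * m → m ≠ 0 ∧ cardFactors c + cardFactors m ≤ 3 := by
    rintro c m rfl
    exact ⟨right_ne_zero_of_mul hn,
      by rwa [← cardFactors_mul (left_ne_zero_of_mul hn) (right_ne_zero_of_mul hn)]⟩
  have hΩ2 : cardFactors 2 = 1 := cardFactors_apply_prime Nat.prime_two
  have hΩ3 : cardFactors 3 = 1 := cardFactors_apply_prime Nat.prime_three
  have hdvd : ∀ {p c a : ℕ}, p.Prime → p * c = a ^ 2 → p ∣ a :=
    fun hp h => hp.dvd_of_dvd_pow (Dvd.intro _ h)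
  by_cases hkp : k.Prime
  · obtain ⟨m, rfl⟩ : k ∣ n := hdvd hkp hkA
    obtain ⟨hm, hΩm⟩ := hcof rfl
    rw [cardFactors_apply_prime hkp] at hΩm
    obtain rfl : A = k * m ^ 2 := Nat.eq_of_mul_eq_mul_left hkp.pos (by rw [hkA]; ring)
    refine ⟨_, isSideSet_of_prime hkp hm, ?_⟩
    have hd : (m ^ 2).divisors.card ≤ 9 := (Nat.card_divisors_pow_le 2 m hm).trans
      (Nat.pow_le_pow_right (n := 3) (j := 2) (by norm_num) (by omega))
    have hcard := Nat.two_mul_card_filter_divisors_add_le (n := k * m) (pow_ne_zero 2 hm)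
    by_cases hk5 : k = 5
    · subst hk5
      by_cases hm5 : m ≤ 5
      · interval_cases m <;> first | contradiction | decide
      · have := hcard {m ^ 2} (by
          simp only [Finset.mem_singleton, forall_eq]
          exact ⟨dvd_rfl, Nat.le_mul_self _, by nlinarith⟩)
        rw [Finset.card_singleton] at this
        omega
    · have h4 : k ≠ 4 := by rintro rfl; revert hkp; decide
      have h6 : k ≠ 6 := by rintro rfl; revert hkp; decide
      have := hcard ∅ (by simp)
      rw [Finset.card_empty] at this
      omega
  have hk7 : k ≠ 7 := by rintro rfl; exact hkp (by norm_num)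
  have hk5 : k ≠ 5 := by rintro rfl; exact hkp (by norm_num)
  refine ⟨_, isSideSet_filter_divisors hA, ?_⟩
  rcases (by omega : k = 4 ∨ k = 6 ∨ k = 8 ∨ 9 ≤ k) with rfl | rfl | rfl | hk9
  · obtain ⟨m, rfl⟩ : 2 ∣ n := hdvd (c := (2 * A)) Nat.prime_two (by omega)
    obtain ⟨hm, hΩm⟩ := hcof rfl
    obtain rfl : A = m ^ 2 := by rw [mul_pow] at hkA; omega
    have hd := Nat.card_divisors_pow_le 2 m hm
    rcases (by omega : cardFactors m ≤ 1 ∨ cardFactors m = 2) with h1 | h2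
    · have := hd.trans (Nat.pow_le_pow_right (n := 3) (j := 1) (by norm_num) h1)
      have := hcard ∅ (by simp)
      rw [Finset.card_empty] at this
      omega
    · rw [h2] at hd
      have key : ∀ q r : ℕ, 2 ≤ q → 2 < r → m = q * r →
          ((m ^ 2).divisors.filter (fun v => m ^ 2 ≤ v * v ∧ v ≤ 2 * m)).card < 4 := by
        intro q r hq hr hqr
        have hrm : r < m := by nlinarith
        have h := hcard {m ^ 2, m * r} (by
          simp only [Finset.mem_insert, Finset.mem_singleton, forall_eq_or_imp, forall_eq]
          refine ⟨⟨dvd_rfl, Nat.le_mul_self _, by nlinarith⟩, ?_,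
            by rw [sq]; exact Nat.mul_le_mul (by nlinarith) (by nlinarith), by nlinarith⟩
          rw [sq]
          exact Nat.mul_dvd_mul_left m (Dvd.intro_left q hqr.symm))
        have hne : m ^ 2 ≠ m * r := by
          rw [sq]
          exact fun h' => hrm.ne' (Nat.eq_of_mul_eq_mul_left (by omega) h')
        rw [Finset.card_pair hne] at h
        omega
      have hm1 : m ≠ 1 := by rintro rfl; simp at h2
      have hq := Nat.minFac_prime hm1
      obtain ⟨r, hr⟩ := Nat.minFac_dvd m
      have hr0 : r ≠ 0 := by rintro rfl; omega
      have hr' : cardFactors r = 1 := by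
        rw [hr, cardFactors_mul hq.ne_zero hr0, cardFactors_apply_prime hq] at h2
        omega
      have hr2 := (cardFactors_eq_one_iff_prime.1 hr').two_le
      rcases hr2.lt_or_eq with h | rfl
      · exact key _ _ hq.two_le h hr
      rcases hq.two_le.lt_or_eq with h | h
      · exact key _ _ le_rfl h (by rw [mul_comm]; exact hr)
      · obtain rfl : m = 4 := by omega
        decide
  · have h2 : 2 ∣ n := hdvd (c := (3 * A)) Nat.prime_two (by omega)
    have h3 : 3 ∣ n := hdvd (c := (2 * A)) Nat.prime_three (by omega)
    obtain ⟨m, rfl⟩ : 2 * 3 ∣ n := by omega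
    obtain ⟨hm, hΩm⟩ := hcof rfl
    rw [cardFactors_mul two_ne_zero three_ne_zero] at hΩm
    obtain rfl : A = 6 * m ^ 2 := by rw [mul_pow] at hkA; omega
    have hd6 : (Nat.divisors 6).card = 4 := by decide
    by_cases hm1 : m = 1
    · subst hm1
      have := hcard ∅ (by simp)
      simp only [one_pow, mul_one, hd6, Finset.card_empty] at this ⊢
      omega
    · have hd := (Nat.card_divisors_pow_le 2 m hm).trans
        (Nat.pow_le_pow_right (n := 3) (j := 1) (by norm_num) (by omega))
      have hd' := Nat.card_divisors_mul_le 6 (m ^ 2)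
      rw [hd6] at hd'
      have := hcard {6 * m ^ 2} (by
        simp only [Finset.mem_singleton, forall_eq]
        have : 2 ≤ m := by omega
        exact ⟨dvd_rfl, Nat.le_mul_self _, by nlinarith⟩)
      rw [Finset.card_singleton] at this
      omega
  · obtain ⟨a, rfl⟩ : 2 ∣ n := hdvd (c := (4 * A)) Nat.prime_two (by omega)
    rw [mul_pow] at hkA
    obtain ⟨m, rfl⟩ : 2 ∣ a := hdvd (c := A) Nat.prime_two (by omega)
    obtain ⟨hm, hΩm⟩ := hcof (c := 2 * 2) (mul_assoc 2 2 m).symm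
    rw [cardFactors_mul two_ne_zero two_ne_zero] at hΩm
    obtain rfl : A = 2 * m ^ 2 := by rw [mul_pow] at hkA; omega
    have hd := (Nat.card_divisors_pow_le 2 m hm).trans
      (Nat.pow_le_pow_right (n := 3) (j := 1) (by norm_num) (by omega))
    have hd' := Nat.card_divisors_mul_le 2 (m ^ 2)
    rw [show (Nat.divisors 2).card = 2 by decide] at hd'
    have := hcard ∅ (by simp)
    rw [Finset.card_empty] at this
    omega
  · have hk0 : k ≠ 0 := by omega
    have hΩk0 : cardFactors k ≠ 0 := by
      rw [Ne, cardFactors_eq_zero_iff_eq_zero_or_one]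
      omega
    have hΩk1 : cardFactors k ≠ 1 := fun h => hkp (cardFactors_eq_one_iff_prime.1 h)
    have hsum := cardFactors_mul hk0 hA
    rw [hkA, cardFactors_pow] at hsum
    have hd := (Nat.card_divisors_pow_le 1 A hA).trans
      (Nat.pow_le_pow_right (n := 2) (j := 4) (by norm_num) (by omega))
    rw [pow_one] at hd
    have := hcard ∅ (by simp)
    rw [Finset.card_empty] at this
    omega

/-- If `n > 1` has at most three prime factors counted with multiplicity, then
the `n × n` square has no perfect Mondrian partition. -/
theorem no_perfect_of_Omega_le_three (n : ℕ) (h₁ : 1 < n)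
    (h₂ : n.primeFactorsList.length ≤ 3) :
    ¬ ∃ P : Mondrian n, 2 ≤ P.rects.card ∧ P.IsPerfect := by
  rintro ⟨P, hk, hP⟩
  obtain ⟨R, hR⟩ := Finset.card_pos.1 (by omega : 0 < P.rects.card)
  have hkA : P.rects.card * R.area = n ^ 2 := by
    rw [← P.sum_area, Finset.sum_congr rfl fun r hr => hP r hr R hR]
    simp
  obtain ⟨S, hS, hlt⟩ := exists_isSideSet_card_lt (by omega)
    (ArithmeticFunction.cardFactors_apply.trans_le h₂) (hP.three_lt_card (by omega) hk) hkA
  refine (hP.card_le fun r hr => ?_).not_gt hlt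
  have hin := P.inside r hr
  exact hS r.w r.h (hP r hr R hR) (by omega) (by omega)
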